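/- Let y ∈ ℝ^{k+1} with y ≠ 0, let t be a real number with t ≠ 1, and set T = t·y (a point on the line through the origin O and y, distinct from y) and δ = |T − y|. Then for every point x on the sphere of radius δ centered at T with x ≠ y, the spherical ratio satisfies ω(x,y) = |T| / δ; in particular ω(x,y) is constant as x ranges over this tangent sphere minus the point y. -/

import Mathlib

/-- The spherical ratio of two distinct points `x, y ∈ ℝ^{k+1}`:
`ω(x,y) = | ‖x‖² − ‖y‖² | / ‖x − y‖²`. -/
noncomputable def sRatio {n : ℕ} (x y : EuclideanSpace ℝ (Fin n)) : ℝ :=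
  |‖x‖ ^ 2 - ‖y‖ ^ 2| / ‖x - y‖ ^ 2

/-- If `x` and `y` are equidistant from `t • y`, then `(t - 1) (‖x‖² - ‖y‖²) = t ‖x - y‖²`. -/
theorem sub_one_mul_norm_sq_sub_norm_sq {E : Type*} [NormedAddCommGroup E]
    [InnerProductSpace ℝ E] {x y : E} {t : ℝ} (h : ‖x - t • y‖ = ‖t • y - y‖) :
    (t - 1) * (‖x‖ ^ 2 - ‖y‖ ^ 2) = t * ‖x - y‖ ^ 2 := by
  have h₂ : ‖x - t • y‖ ^ 2 = ‖t • y - y‖ ^ 2 := by rw [h]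
  simp only [norm_sub_sq_real, real_inner_smul_right, real_inner_smul_left, norm_smul,
    mul_pow, Real.norm_eq_abs, sq_abs, real_inner_self_eq_norm_sq] at h₂ ⊢
  linear_combination -h₂

theorem stmt_12 (k : ℕ) (y : EuclideanSpace ℝ (Fin (k + 1))) (hy : y ≠ 0)
    (t : ℝ) (ht : t ≠ 1) :
    ∀ x ∈ Metric.sphere (t • y) ‖t • y - y‖, x ≠ y →
      sRatio x y = ‖t • y‖ / ‖t • y - y‖ := by
  intro x hx hxy
  have key := sub_one_mul_norm_sq_sub_norm_sq (mem_sphere_iff_norm.mp hx)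
  have habs := congrArg abs key
  rw [abs_mul, abs_mul, abs_of_nonneg (sq_nonneg ‖x - y‖)] at habs
  have hy₀ : ‖y‖ ≠ 0 := norm_ne_zero_iff.mpr hy
  have ht₀ : |t - 1| ≠ 0 := abs_ne_zero.mpr (sub_ne_zero.mpr ht)
  have hd : ‖x - y‖ ^ 2 ≠ 0 := pow_ne_zero 2 (norm_ne_zero_iff.mpr (sub_ne_zero.mpr hxy))
  have hT : t • y - y = (t - 1) • y := by rw [sub_smul, one_smul]
  rw [sRatio, hT, norm_smul, norm_smul, mul_div_mul_right _ _ hy₀, Real.norm_eq_abs,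
    Real.norm_eq_abs, div_eq_div_iff hd ht₀, mul_comm, habs]
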